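/- Let g and ḡ be projectively equivalent metrics on U, let L_{ij} := (g(x)·L(x))_{ij} be the (0,2)-tensor obtained by lowering an index of L with g, and let λ := (1/2)·trace(L). Then L_{ij} satisfies ∇_k L_{ij} = (∂_i λ) g_{jk} + (∂_j λ) g_{ik} at every point of U. -/

import Mathlib

open Matrix

noncomputable section

/-- Partial derivative in the `i`-th coordinate direction of a real-valued function on `ℝⁿ`. -/
def pd {n : ℕ} (i : Fin n) (f : (Fin n → ℝ) → ℝ) : (Fin n → ℝ) → ℝ :=
  fun x => fderiv ℝ f x (Pi.single i 1)

/-- Iterated partial derivatives along a list of coordinate directions. -/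
def iterPD {n : ℕ} : List (Fin n) → ((Fin n → ℝ) → ℝ) → ((Fin n → ℝ) → ℝ)
  | [], f => f
  | i :: l, f => pd i (iterPD l f)

/-- `g` is a (pseudo-Riemannian) metric on `U`: a smooth field of invertible symmetric
real `n×n` matrices. -/
structure IsMetricOn {n : ℕ} (U : Set (Fin n → ℝ))
    (g : (Fin n → ℝ) → Matrix (Fin n) (Fin n) ℝ) : Prop where
  smooth : ∀ i j : Fin n, ContDiffOn ℝ (⊤ : ℕ∞) (fun x => g x i j) U
  symm : ∀ x ∈ U, (g x).IsSymm
  nondeg : ∀ x ∈ U, IsUnit (g x).det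

/-- The Christoffel symbols `Γ^k_{ij}` of the metric `g`. -/
def Gamma {n : ℕ} (g : (Fin n → ℝ) → Matrix (Fin n) (Fin n) ℝ)
    (k i j : Fin n) (x : Fin n → ℝ) : ℝ :=
  (1/2) * ∑ ℓ, (g x)⁻¹ k ℓ *
    (pd i (fun y => g y ℓ j) x + pd j (fun y => g y ℓ i) x - pd ℓ (fun y => g y i j) x)

/-- An open interval of `ℝ` (possibly empty or unbounded): an open order-connected set. -/
def IsOpenInterval (I : Set ℝ) : Prop := IsOpen I ∧ I.OrdConnected

/-- `γ` is a `g`-geodesic defined on the open interval `I`, with values in `U`. -/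
structure IsGeodesicOn {n : ℕ} (U : Set (Fin n → ℝ))
    (g : (Fin n → ℝ) → Matrix (Fin n) (Fin n) ℝ)
    (γ : ℝ → (Fin n → ℝ)) (I : Set ℝ) : Prop where
  interval : IsOpenInterval I
  smooth : ∀ k : Fin n, ContDiffOn ℝ (⊤ : ℕ∞) (fun s => γ s k) I
  mem : ∀ t ∈ I, γ t ∈ U
  eqn : ∀ t ∈ I, ∀ k : Fin n,
    deriv (deriv fun s => γ s k) t
      + ∑ i, ∑ j, Gamma g k i j (γ t) * deriv (fun s => γ s i) t * deriv (fun s => γ s j) t = 0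

/-- `g` and `gbar` are projectively equivalent on `U`: every `g`-geodesic with nowhere
vanishing velocity becomes, after a smooth reparameterization (a diffeomorphism of open
intervals), a `gbar`-geodesic. -/
def ProjEquiv {n : ℕ} (U : Set (Fin n → ℝ))
    (g gbar : (Fin n → ℝ) → Matrix (Fin n) (Fin n) ℝ) : Prop :=
  ∀ (γ : ℝ → (Fin n → ℝ)) (I : Set ℝ), IsGeodesicOn U g γ I →
    (∀ t ∈ I, ∃ k, deriv (fun s => γ s k) t ≠ 0) →
    ∃ (φ : ℝ → ℝ) (J : Set ℝ), IsOpenInterval J ∧ ContDiffOn ℝ (⊤ : ℕ∞) φ J ∧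
      Set.InjOn φ J ∧ φ '' J = I ∧ (∀ t ∈ J, deriv φ t ≠ 0) ∧
      IsGeodesicOn U gbar (γ ∘ φ) J

/-- The (1,1)-tensor `L = |det gbar / det g|^{1/(n+1)} gbar⁻¹ g` built from `g` and `gbar`. -/
def Lfield {n : ℕ} (g gbar : (Fin n → ℝ) → Matrix (Fin n) (Fin n) ℝ)
    (x : Fin n → ℝ) : Matrix (Fin n) (Fin n) ℝ :=
  |(gbar x).det / (g x).det| ^ ((1 : ℝ)/((n : ℝ)+1)) • ((gbar x)⁻¹ * g x)

/-- The family `S(t) = adjugate (t·Id − L)`. -/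
def Sfield {n : ℕ} (g gbar : (Fin n → ℝ) → Matrix (Fin n) (Fin n) ℝ) (t : ℝ)
    (x : Fin n → ℝ) : Matrix (Fin n) (Fin n) ℝ :=
  (t • (1 : Matrix (Fin n) (Fin n) ℝ) - Lfield g gbar x).adjugate

/-- The second order operator associated (via Carter's quantization) to a field `A` of
symmetric matrices: `Â f = |det g|^{-1/2} ∑ᵢⱼ ∂ᵢ(|det g|^{1/2} Aⁱʲ ∂ⱼ f)`. -/
def assocOp {n : ℕ} (g A : (Fin n → ℝ) → Matrix (Fin n) (Fin n) ℝ)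
    (f : (Fin n → ℝ) → ℝ) (x : Fin n → ℝ) : ℝ :=
  |(g x).det| ^ (-(1 : ℝ)/2) * ∑ i, ∑ j,
    pd i (fun y => |(g y).det| ^ ((1 : ℝ)/2) * A y i j * pd j f y) x

/-- The operator `K̂^{(t)}`, associated to `A = S(t)·g⁻¹`. -/
def Khat {n : ℕ} (g gbar : (Fin n → ℝ) → Matrix (Fin n) (Fin n) ℝ) (t : ℝ)
    (f : (Fin n → ℝ) → ℝ) (x : Fin n → ℝ) : ℝ :=
  assocOp g (fun y => Sfield g gbar t y * (g y)⁻¹) f x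

/-- The Beltrami-Laplace operator of `g`, associated to `A = g⁻¹`. -/
def LaplaceOp {n : ℕ} (g : (Fin n → ℝ) → Matrix (Fin n) (Fin n) ℝ)
    (f : (Fin n → ℝ) → ℝ) (x : Fin n → ℝ) : ℝ :=
  assocOp g (fun y => (g y)⁻¹) f x

/-- `K` is a Killing tensor for `g` on `U`: the associated quadratic function is constant
along every `g`-geodesic. -/
def IsKillingTensorOn {n : ℕ} (U : Set (Fin n → ℝ))
    (g K : (Fin n → ℝ) → Matrix (Fin n) (Fin n) ℝ) : Prop :=
  ∀ (γ : ℝ → (Fin n → ℝ)) (I : Set ℝ), IsGeodesicOn U g γ I →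
    ∀ τ₁ ∈ I, ∀ τ₂ ∈ I,
      (∑ i, ∑ j, deriv (fun s => γ s i) τ₁ * K (γ τ₁) i j * deriv (fun s => γ s j) τ₁) =
      (∑ i, ∑ j, deriv (fun s => γ s i) τ₂ * K (γ τ₂) i j * deriv (fun s => γ s j) τ₂)

/-- The covariant derivative `∇_k T_{ij}` of a (0,2)-tensor field `T`. -/
def covDeriv2 {n : ℕ} (g T : (Fin n → ℝ) → Matrix (Fin n) (Fin n) ℝ)
    (k i j : Fin n) (x : Fin n → ℝ) : ℝ :=
  pd k (fun y => T y i j) x - (∑ s, Gamma g s k i x * T x s j)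
    - ∑ s, Gamma g s k j x * T x i s

/-- The Ricci curvature tensor `R_{ij}` of `g`. -/
def Ricci {n : ℕ} (g : (Fin n → ℝ) → Matrix (Fin n) (Fin n) ℝ)
    (i j : Fin n) (x : Fin n → ℝ) : ℝ :=
  (∑ ℓ, pd ℓ (fun y => Gamma g ℓ i j y) x) - (∑ ℓ, pd i (fun y => Gamma g ℓ ℓ j y) x)
    + ∑ ℓ, ∑ s, (Gamma g ℓ ℓ s x * Gamma g s i j x - Gamma g ℓ i s x * Gamma g s ℓ j x)

/-- A function vanishes up to order `k` at `p`: it and all its partial derivatives of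
order `≤ k` vanish at `p`. -/
def VanishUpTo {n : ℕ} (k : ℕ) (f : (Fin n → ℝ) → ℝ) (p : Fin n → ℝ) : Prop :=
  ∀ l : List (Fin n), l.length ≤ k → iterPD l f p = 0


/-- The plain (flat) second order operator `Â f = ∑ᵢⱼ ∂ᵢ(Aⁱʲ ∂ⱼ f)` associated to a
matrix field `A`. -/
def opPlain {n : ℕ} (A : (Fin n → ℝ) → Matrix (Fin n) (Fin n) ℝ)
    (f : (Fin n → ℝ) → ℝ) (x : Fin n → ℝ) : ℝ :=
  ∑ i, ∑ j, pd i (fun y => A y i j * pd j f y) x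

end

/-- The entrywise partial derivative of a matrix field. -/
noncomputable def matPd {n : ℕ} (k : Fin n) (A : (Fin n → ℝ) → Matrix (Fin n) (Fin n) ℝ)
    (x : Fin n → ℝ) : Matrix (Fin n) (Fin n) ℝ :=
  Matrix.of fun i j => pd k (fun y => A y i j) x

/-- The matrix `(Γ_k)^a_b = Γ^a_{kb}` of Christoffel symbols. -/
noncomputable def GammaMat {n : ℕ} (g : (Fin n → ℝ) → Matrix (Fin n) (Fin n) ℝ) (k : Fin n)
    (x : Fin n → ℝ) : Matrix (Fin n) (Fin n) ℝ :=
  Matrix.of fun a b => Gamma g a k b x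

theorem pd_congr {n : ℕ} {k : Fin n} {f h : (Fin n → ℝ) → ℝ} {x : Fin n → ℝ}
    (hfh : f =ᶠ[nhds x] h) : pd k f x = pd k h x := by
  simp only [pd, hfh.fderiv_eq]

theorem pd_mul {n : ℕ} {k : Fin n} {f h : (Fin n → ℝ) → ℝ} {x : Fin n → ℝ}
    (hf : DifferentiableAt ℝ f x) (hh : DifferentiableAt ℝ h x) :
    pd k (fun y => f y * h y) x = pd k f x * h x + f x * pd k h x := by
  simp only [pd]
  rw [fderiv_fun_mul hf hh]
  simp
  ring

theorem pd_sum {n : ℕ} {ι : Type*} (s : Finset ι) {k : Fin n} {f : ι → (Fin n → ℝ) → ℝ}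
    {x : Fin n → ℝ} (hf : ∀ i ∈ s, DifferentiableAt ℝ (f i) x) :
    pd k (fun y => ∑ i ∈ s, f i y) x = ∑ i ∈ s, pd k (f i) x := by
  simp only [pd]
  rw [fderiv_fun_sum hf]
  simp

theorem matPd_mul {n : ℕ} {k : Fin n} {A B : (Fin n → ℝ) → Matrix (Fin n) (Fin n) ℝ}
    {x : Fin n → ℝ} (hA : ∀ i j, DifferentiableAt ℝ (fun y => A y i j) x)
    (hB : ∀ i j, DifferentiableAt ℝ (fun y => B y i j) x) :
    matPd k (fun y => A y * B y) x = matPd k A x * B x + A x * matPd k B x := by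
  ext i j
  simp only [matPd, Matrix.mul_apply, Matrix.of_apply, Matrix.add_apply]
  rw [pd_sum (f := fun l y => A y i l * B y l j) _ fun l _ => (hA i l).mul (hB l j),
    ← Finset.sum_add_distrib]
  exact Finset.sum_congr rfl fun l _ => pd_mul (hA i l) (hB l j)

theorem matPd_smul {n : ℕ} {k : Fin n} {f : (Fin n → ℝ) → ℝ}
    {A : (Fin n → ℝ) → Matrix (Fin n) (Fin n) ℝ}
    {x : Fin n → ℝ} (hf : DifferentiableAt ℝ f x)
    (hA : ∀ i j, DifferentiableAt ℝ (fun y => A y i j) x) :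
    matPd k (fun y => f y • A y) x = pd k f x • A x + f x • matPd k A x := by
  ext i j
  simp only [matPd, Matrix.smul_apply, smul_eq_mul, Matrix.of_apply, Matrix.add_apply]
  exact pd_mul hf (hA i j)

theorem differentiableAt_mul_entry {n : ℕ} {A B : (Fin n → ℝ) → Matrix (Fin n) (Fin n) ℝ}
    {x : Fin n → ℝ} (hA : ∀ i j, DifferentiableAt ℝ (fun y => A y i j) x)
    (hB : ∀ i j, DifferentiableAt ℝ (fun y => B y i j) x) (i j : Fin n) :
    DifferentiableAt ℝ (fun y => (A y * B y) i j) x := by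
  simp only [Matrix.mul_apply]
  exact DifferentiableAt.fun_sum fun l _ => (hA i l).mul (hB l j)

theorem contDiffOn_det {E : Type*} [NormedAddCommGroup E] [NormedSpace ℝ E] {n : ℕ}
    {m : WithTop ℕ∞} {U : Set E} {A : E → Matrix (Fin n) (Fin n) ℝ}
    (hA : ∀ i j, ContDiffOn ℝ m (fun y => A y i j) U) :
    ContDiffOn ℝ m (fun y => (A y).det) U := by
  simp only [Matrix.det_apply']
  exact ContDiffOn.sum fun σ _ => contDiffOn_const.mul (contDiffOn_prod fun i _ => hA _ _)

theorem contDiffOn_inv_entry {E : Type*} [NormedAddCommGroup E] [NormedSpace ℝ E] {n : ℕ}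
    {m : WithTop ℕ∞} {U : Set E} {A : E → Matrix (Fin n) (Fin n) ℝ}
    (hA : ∀ i j, ContDiffOn ℝ m (fun y => A y i j) U) (hdet : ∀ x ∈ U, IsUnit (A x).det)
    (i j : Fin n) : ContDiffOn ℝ m (fun y => (A y)⁻¹ i j) U := by
  simp only [Matrix.inv_def, Ring.inverse_eq_inv', Matrix.smul_apply, smul_eq_mul,
    Matrix.adjugate_apply]
  refine ((contDiffOn_det hA).inv fun x hx => (hdet x hx).ne_zero).mul
    (contDiffOn_det fun a b => ?_)
  by_cases h : a = j
  · subst h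
    simpa using contDiffOn_const
  · simpa [Matrix.updateRow_ne h] using hA a b

theorem pd_det {n : ℕ} {k : Fin n} {A : (Fin n → ℝ) → Matrix (Fin n) (Fin n) ℝ}
    {x : Fin n → ℝ} (hA : ∀ i j, DifferentiableAt ℝ (fun y => A y i j) x)
    (hdet : IsUnit (A x).det) :
    pd k (fun y => (A y).det) x = (A x).det * ((A x)⁻¹ * matPd k A x).trace := by
  let D : ContinuousMultilinearMap ℝ (fun _ : Fin n => Fin n → ℝ) ℝ :=
    ⟨(Matrix.detRowAlternating (n := Fin n) (R := ℝ)).toMultilinearMap,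
      Continuous.matrix_det continuous_id⟩
  have hD : ∀ M : Fin n → Fin n → ℝ, D M = Matrix.det (Matrix.of M) := fun _ => rfl
  have hrow : ∀ i, HasFDerivAt (fun y => A y i)
      (ContinuousLinearMap.pi fun j => fderiv ℝ (fun y => A y i j) x) x := fun i =>
    hasFDerivAt_pi.2 fun j => (hA i j).hasFDerivAt
  have hmat : HasFDerivAt (fun y i => A y i)
      (ContinuousLinearMap.pi fun i =>
        ContinuousLinearMap.pi fun j => fderiv ℝ (fun y => A y i j) x) x :=
    hasFDerivAt_pi.2 hrow
  have hcomp : HasFDerivAt (fun y => (A y).det) _ x :=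
    HasFDerivAt.comp x (g := D) (D.hasFDerivAt (x := fun i => A x i)) hmat
  rw [pd, hcomp.fderiv]
  have hadj : (A x).det • (A x)⁻¹ = (A x).adjugate := by
    rw [Matrix.inv_def, smul_smul, Ring.mul_inverse_cancel _ hdet, one_smul]
  rw [← smul_eq_mul, ← Matrix.trace_smul, ← Matrix.smul_mul, hadj, Matrix.trace_mul_comm]
  simp only [ContinuousLinearMap.comp_apply, ContinuousMultilinearMap.linearDeriv_apply,
    ContinuousLinearMap.coe_pi', Matrix.trace, Matrix.diag_apply]
  refine Finset.sum_congr rfl fun i _ => ?_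
  have h1 : ∀ b : Fin n → ℝ, D (Function.update (fun i => A x i) i b)
      = Matrix.cramer (A x)ᵀ b i := fun b => by
    rw [Matrix.cramer_transpose_apply, hD]; rfl
  rw [h1, Matrix.cramer_eq_adjugate_mulVec, ← Matrix.adjugate_transpose]
  simp only [Matrix.mulVec, dotProduct, Matrix.transpose_apply, Matrix.mul_apply, matPd,
    Matrix.of_apply, pd]
  exact Finset.sum_congr rfl fun j _ => mul_comm _ _

theorem IsMetricOn.differentiableAt {n : ℕ} {U : Set (Fin n → ℝ)} (hU : IsOpen U)
    {g : (Fin n → ℝ) → Matrix (Fin n) (Fin n) ℝ} (hg : IsMetricOn U g)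
    {x : Fin n → ℝ} (hx : x ∈ U) (i j : Fin n) : DifferentiableAt ℝ (fun y => g y i j) x :=
  ((hg.smooth i j).contDiffAt (hU.mem_nhds hx)).differentiableAt (by simp)

theorem matPd_inv {n : ℕ} {k : Fin n} {U : Set (Fin n → ℝ)} (hU : IsOpen U)
    {A : (Fin n → ℝ) → Matrix (Fin n) (Fin n) ℝ} (hA : IsMetricOn U A)
    {x : Fin n → ℝ} (hx : x ∈ U) :
    matPd k (fun y => (A y)⁻¹) x = -((A x)⁻¹ * matPd k A x * (A x)⁻¹) := by
  have hdA := hA.differentiableAt hU hx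
  have hdI : ∀ i j, DifferentiableAt ℝ (fun y => (A y)⁻¹ i j) x := fun i j =>
    ((contDiffOn_inv_entry hA.smooth hA.nondeg i j).contDiffAt
      (hU.mem_nhds hx)).differentiableAt (by simp)
  have h1 := matPd_mul (k := k) hdI hdA
  have h0 : matPd k (fun y => (A y)⁻¹ * A y) x = 0 := by
    ext i j
    have : (fun y => ((A y)⁻¹ * A y) i j) =ᶠ[nhds x]
        fun _ => (1 : Matrix (Fin n) (Fin n) ℝ) i j := by
      filter_upwards [hU.mem_nhds hx] with y hy
      rw [Matrix.nonsing_inv_mul _ (hA.nondeg y hy)]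
    simp only [matPd, Matrix.of_apply]
    rw [pd_congr this]
    simp [pd]
  rw [h0] at h1
  have h2 := congrArg (· * (A x)⁻¹) h1
  simp only [zero_mul, add_mul, Matrix.mul_nonsing_inv_cancel_right _ _ (hA.nondeg x hx)] at h2
  exact eq_neg_of_add_eq_zero_left h2.symm

theorem IsMetricOn.pd_symm {n : ℕ} {U : Set (Fin n → ℝ)} (hU : IsOpen U)
    {g : (Fin n → ℝ) → Matrix (Fin n) (Fin n) ℝ} (hg : IsMetricOn U g)
    {x : Fin n → ℝ} (hx : x ∈ U) (k i j : Fin n) :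
    pd k (fun y => g y i j) x = pd k (fun y => g y j i) x := by
  refine pd_congr ?_
  filter_upwards [hU.mem_nhds hx] with y hy
  exact (hg.symm y hy).apply j i

theorem Gamma_symm {n : ℕ} {U : Set (Fin n → ℝ)} (hU : IsOpen U)
    {g : (Fin n → ℝ) → Matrix (Fin n) (Fin n) ℝ} (hg : IsMetricOn U g)
    {x : Fin n → ℝ} (hx : x ∈ U) (k i j : Fin n) : Gamma g k i j x = Gamma g k j i x := by
  simp only [Gamma]
  congr 1
  refine Finset.sum_congr rfl fun l _ => ?_
  rw [hg.pd_symm hU hx l i j]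
  ring

theorem mul_GammaMat_apply {n : ℕ} {U : Set (Fin n → ℝ)}
    {g : (Fin n → ℝ) → Matrix (Fin n) (Fin n) ℝ} (hg : IsMetricOn U g)
    {x : Fin n → ℝ} (hx : x ∈ U) (k i j : Fin n) :
    (g x * GammaMat g k x) i j = (1/2) * (pd k (fun y => g y i j) x +
      pd j (fun y => g y i k) x - pd i (fun y => g y k j) x) := by
  let w : Matrix (Fin n) (Fin n) ℝ := Matrix.of fun l j => (1/2) * (pd k (fun y => g y l j) x +
      pd j (fun y => g y l k) x - pd l (fun y => g y k j) x)
  have : GammaMat g k x = (g x)⁻¹ * w := by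
    ext a b
    simp only [GammaMat, Gamma, Matrix.of_apply, Matrix.mul_apply, w, Finset.mul_sum]
    exact Finset.sum_congr rfl fun l _ => by ring
  rw [this, Matrix.mul_nonsing_inv_cancel_left _ _ (hg.nondeg x hx)]
  rfl

/-- The Levi-Civita connection is metric. -/
theorem matPd_metric {n : ℕ} {U : Set (Fin n → ℝ)} (hU : IsOpen U)
    {g : (Fin n → ℝ) → Matrix (Fin n) (Fin n) ℝ} (hg : IsMetricOn U g)
    {x : Fin n → ℝ} (hx : x ∈ U) (k : Fin n) :
    matPd k g x = (GammaMat g k x)ᵀ * g x + g x * GammaMat g k x := by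
  have h : (GammaMat g k x)ᵀ * g x = (g x * GammaMat g k x)ᵀ := by
    rw [Matrix.transpose_mul, (hg.symm x hx).eq]
  ext i j
  rw [h, Matrix.add_apply, Matrix.transpose_apply, mul_GammaMat_apply hg hx,
    mul_GammaMat_apply hg hx, hg.pd_symm hU hx k j i, hg.pd_symm hU hx i j k,
    hg.pd_symm hU hx j i k]
  simp only [matPd, Matrix.of_apply]
  ring

theorem trace_inv_mul_matPd {n : ℕ} {U : Set (Fin n → ℝ)} (hU : IsOpen U)
    {g : (Fin n → ℝ) → Matrix (Fin n) (Fin n) ℝ} (hg : IsMetricOn U g)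
    {x : Fin n → ℝ} (hx : x ∈ U) (k : Fin n) :
    ((g x)⁻¹ * matPd k g x).trace = 2 * (GammaMat g k x).trace := by
  rw [matPd_metric hU hg hx, mul_add, Matrix.trace_add,
    Matrix.nonsing_inv_mul_cancel_left _ _ (hg.nondeg x hx), Matrix.trace_mul_comm,
    Matrix.mul_nonsing_inv_cancel_right _ _ (hg.nondeg x hx), Matrix.trace_transpose]
  ring

theorem contDiffOn_Gamma {n : ℕ} {U : Set (Fin n → ℝ)} (hU : IsOpen U)
    {g : (Fin n → ℝ) → Matrix (Fin n) (Fin n) ℝ} (hg : IsMetricOn U g) (k i j : Fin n) :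
    ContDiffOn ℝ (⊤ : ℕ∞) (Gamma g k i j) U := by
  have hpd : ∀ k i j, ContDiffOn ℝ (⊤ : ℕ∞) (pd k fun y => g y i j) U := fun k i j =>
    ((hg.smooth i j).fderiv_of_isOpen hU (by simp)).clm_apply contDiffOn_const
  exact contDiffOn_const.mul (ContDiffOn.sum fun l _ =>
    (contDiffOn_inv_entry hg.smooth hg.nondeg k l).mul (((hpd _ _ _).add (hpd _ _ _)).sub
      (hpd _ _ _)))

theorem pd_detRatio_rpow {n : ℕ} {U : Set (Fin n → ℝ)} (hU : IsOpen U)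
    {g gbar : (Fin n → ℝ) → Matrix (Fin n) (Fin n) ℝ}
    (hg : IsMetricOn U g) (hgbar : IsMetricOn U gbar) (p : ℝ)
    {x : Fin n → ℝ} (hx : x ∈ U) (k : Fin n) :
    DifferentiableAt ℝ (fun y => |(gbar y).det / (g y).det| ^ p) x ∧
    pd k (fun y => |(gbar y).det / (g y).det| ^ p) x =
      2 * p * ((GammaMat gbar k x).trace - (GammaMat g k x).trace) *
        |(gbar x).det / (g x).det| ^ p := by
  have key : (fun y => |(gbar y).det / (g y).det| ^ p) =ᶠ[nhds x]
      fun y => Real.exp ((Real.log (gbar y).det - Real.log (g y).det) * p) := by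
    filter_upwards [hU.mem_nhds hx] with y hy
    have h1 := (hg.nondeg y hy).ne_zero
    have h2 := (hgbar.nondeg y hy).ne_zero
    rw [Real.rpow_def_of_pos (abs_pos.2 (div_ne_zero h2 h1)), Real.log_abs, Real.log_div h2 h1]
  have hdet : ∀ {h : (Fin n → ℝ) → Matrix (Fin n) (Fin n) ℝ}, IsMetricOn U h →
      HasFDerivAt (fun y => Real.log (h y).det)
        ((h x).det⁻¹ • fderiv ℝ (fun y => (h y).det) x) x := fun {h} hh =>
    HasFDerivAt.log ((((contDiffOn_det hh.smooth).contDiffAt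
      (hU.mem_nhds hx)).differentiableAt (by simp)).hasFDerivAt) (hh.nondeg x hx).ne_zero
  have hlog : ∀ {h : (Fin n → ℝ) → Matrix (Fin n) (Fin n) ℝ}, IsMetricOn U h →
      (h x).det⁻¹ * fderiv ℝ (fun y => (h y).det) x (Pi.single k 1) =
        2 * (GammaMat h k x).trace := fun {h} hh => by
    have := pd_det (k := k) (fun i j => hh.differentiableAt hU hx i j) (hh.nondeg x hx)
    rw [trace_inv_mul_matPd hU hh hx, pd] at this
    rw [this, inv_mul_cancel_left₀ (hh.nondeg x hx).ne_zero]
  have hexp := (((hdet hgbar).sub (hdet hg)).mul_const p).exp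
  refine ⟨hexp.differentiableAt.congr_of_eventuallyEq key, ?_⟩
  have h0 := key.self_of_nhds
  simp only at h0
  rw [pd_congr key, h0, pd]
  have h1 := hexp.fderiv
  simp only [Pi.sub_apply] at h1
  rw [h1]
  simp only [_root_.smul_apply, _root_.sub_apply, smul_eq_mul,
    hlog hg, hlog hgbar]
  ring

theorem covDeriv2_eq_matPd {n : ℕ} (g T : (Fin n → ℝ) → Matrix (Fin n) (Fin n) ℝ)
    (k i j : Fin n) (x : Fin n → ℝ) :
    covDeriv2 g T k i j x =
      (matPd k T x - (GammaMat g k x)ᵀ * T x - T x * GammaMat g k x) i j := by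
  simp only [covDeriv2, matPd, GammaMat, Matrix.sub_apply, Matrix.mul_apply, Matrix.of_apply,
    Matrix.transpose_apply]
  congr 1
  exact Finset.sum_congr rfl fun s _ => mul_comm _ _

section Connection

variable {n : ℕ} {U : Set (Fin n → ℝ)} {g gbar : (Fin n → ℝ) → Matrix (Fin n) (Fin n) ℝ}
  {x : Fin n → ℝ} {φ : Fin n → ℝ}

theorem GammaMat_eq_add
    (hφ : ∀ a k b, Gamma gbar a k b x - Gamma g a k b x =
      φ k * (if a = b then 1 else 0) + φ b * (if a = k then 1 else 0)) (k : Fin n) :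
    GammaMat gbar k x = GammaMat g k x + (φ k • (1 : Matrix (Fin n) (Fin n) ℝ) +
      Matrix.vecMulVec (Pi.single k 1) φ) := by
  ext a b
  have := hφ a k b
  simp only [GammaMat, Matrix.of_apply, Matrix.add_apply, Matrix.smul_apply, Matrix.one_apply,
    Matrix.vecMulVec_apply, Pi.single_apply, smul_eq_mul]
  linarith

theorem trace_GammaMat_sub
    (hφ : ∀ a k b, Gamma gbar a k b x - Gamma g a k b x =
      φ k * (if a = b then 1 else 0) + φ b * (if a = k then 1 else 0)) (k : Fin n) :
    (GammaMat gbar k x).trace - (GammaMat g k x).trace = (n + 1) * φ k := by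
  rw [GammaMat_eq_add hφ, Matrix.trace_add, Matrix.trace_add, Matrix.trace_smul,
    Matrix.trace_one, Matrix.trace_vecMulVec, single_one_dotProduct]
  simp
  ring

theorem matPd_Lfield (hU : IsOpen U) (hg : IsMetricOn U g) (hgbar : IsMetricOn U gbar)
    (hx : x ∈ U)
    (hφ : ∀ a k b, Gamma gbar a k b x - Gamma g a k b x =
      φ k * (if a = b then 1 else 0) + φ b * (if a = k then 1 else 0)) (k : Fin n) :
    (∀ i j, DifferentiableAt ℝ (fun y => Lfield g gbar y i j) x) ∧
    matPd k (Lfield g gbar) x = |(gbar x).det / (g x).det| ^ ((1 : ℝ)/((n : ℝ)+1)) •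
      ((gbar x)⁻¹ * g x * GammaMat g k x - GammaMat g k x * ((gbar x)⁻¹ * g x)
        - (gbar x)⁻¹ * Matrix.vecMulVec φ (Pi.single k 1) * g x
        - Matrix.vecMulVec (Pi.single k 1) φ * (gbar x)⁻¹ * g x) := by
  obtain ⟨hψd, hψ⟩ := pd_detRatio_rpow hU hg hgbar ((1 : ℝ)/((n : ℝ)+1)) hx k
  have hdg := hg.differentiableAt hU hx
  have hdI : ∀ i j, DifferentiableAt ℝ (fun y => (gbar y)⁻¹ i j) x := fun i j =>
    ((contDiffOn_inv_entry hgbar.smooth hgbar.nondeg i j).contDiffAt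
      (hU.mem_nhds hx)).differentiableAt (by simp)
  refine ⟨fun i j => hψd.mul (differentiableAt_mul_entry hdI hdg i j), ?_⟩
  have hn : (n : ℝ) + 1 ≠ 0 := by positivity
  rw [trace_GammaMat_sub hφ] at hψ
  have hψ' : pd k (fun y => |(gbar y).det / (g y).det| ^ ((1 : ℝ)/((n : ℝ)+1))) x =
      |(gbar x).det / (g x).det| ^ ((1 : ℝ)/((n : ℝ)+1)) * (2 * φ k) := by
    rw [hψ]
    field_simp
  have h1 : matPd k (Lfield g gbar) x = _ :=
    matPd_smul (k := k) hψd (differentiableAt_mul_entry hdI hdg)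
  rw [h1, hψ', mul_smul, ← smul_add, matPd_mul hdI hdg, matPd_inv hU hgbar hx,
    matPd_metric hU hgbar hx, matPd_metric hU hg hx, mul_add (gbar x)⁻¹ _ (gbar x * _),
    Matrix.nonsing_inv_mul_cancel_left _ _ (hgbar.nondeg x hx), add_mul _ _ (gbar x)⁻¹,
    ← mul_assoc (gbar x)⁻¹ _ (gbar x),
    Matrix.mul_nonsing_inv_cancel_right _ _ (hgbar.nondeg x hx), GammaMat_eq_add hφ]
  congr 1
  simp only [Matrix.transpose_add, Matrix.transpose_smul, Matrix.transpose_one,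
    Matrix.transpose_vecMulVec, mul_add, add_mul, neg_add, neg_mul, Matrix.smul_mul,
    Matrix.mul_smul, one_mul, mul_one, mul_assoc, two_mul, add_smul]
  abel

theorem covDeriv2_lowered_Lfield (hU : IsOpen U) (hg : IsMetricOn U g)
    (hgbar : IsMetricOn U gbar) (hx : x ∈ U)
    (hφ : ∀ a k b, Gamma gbar a k b x - Gamma g a k b x =
      φ k * (if a = b then 1 else 0) + φ b * (if a = k then 1 else 0)) (k i j : Fin n) :
    covDeriv2 g (fun y => g y * Lfield g gbar y) k i j x =
      pd i (fun y => (1/2) * (Lfield g gbar y).trace) x * g x j k +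
        pd j (fun y => (1/2) * (Lfield g gbar y).trace) x * g x i k := by
  set ψ := |(gbar x).det / (g x).det| ^ ((1 : ℝ)/((n : ℝ)+1)) with hψ
  set w : Fin n → ℝ := (g x * (gbar x)⁻¹) *ᵥ φ with hw
  have hgs := (hg.symm x hx).eq
  have hgbs : ((gbar x)⁻¹)ᵀ = (gbar x)⁻¹ := by
    rw [Matrix.transpose_nonsing_inv, (hgbar.symm x hx).eq]
  have hw' : φ ᵥ* ((gbar x)⁻¹ * g x) = w := by
    rw [hw, ← Matrix.vecMul_transpose, Matrix.transpose_mul, hgs, hgbs]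
  have hpd : ∀ k, pd k (fun y => (1/2) * (Lfield g gbar y).trace) x = -(ψ * w k) := fun k => by
    obtain ⟨hd, h⟩ := matPd_Lfield hU hg hgbar hx hφ k
    have h2 : pd k (fun y => (1/2) * (Lfield g gbar y).trace) x =
        1/2 * (matPd k (Lfield g gbar) x).trace := by
      simp only [Matrix.trace, Matrix.diag_apply, matPd, Matrix.of_apply]
      rw [← pd_sum _ fun i _ => hd i i, pd_mul (by fun_prop)
        (DifferentiableAt.fun_sum fun i _ => hd i i)]
      simp [pd]
    have t1 : ((gbar x)⁻¹ * Matrix.vecMulVec φ (Pi.single k 1) * g x).trace = w k := by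
      rw [Matrix.trace_mul_comm, ← mul_assoc, Matrix.mul_vecMulVec, Matrix.trace_vecMulVec,
        dotProduct_single_one]
    have t2 : (Matrix.vecMulVec (Pi.single k 1) φ * (gbar x)⁻¹ * g x).trace = w k := by
      rw [mul_assoc, Matrix.vecMulVec_mul, Matrix.trace_vecMulVec, hw', single_one_dotProduct]
    rw [h2, h, Matrix.trace_smul, Matrix.trace_sub, Matrix.trace_sub, Matrix.trace_sub, t1, t2,
      Matrix.trace_mul_comm ((gbar x)⁻¹ * g x)]
    simp only [smul_eq_mul]
    ring
  obtain ⟨hd, h⟩ := matPd_Lfield hU hg hgbar hx hφ k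
  have hcov : matPd k (fun y => g y * Lfield g gbar y) x
      - (GammaMat g k x)ᵀ * (g x * Lfield g gbar x) - g x * Lfield g gbar x * GammaMat g k x =
      -(ψ • (Matrix.vecMulVec w (g x k) + Matrix.vecMulVec (g x k) w)) := by
    have e1 : g x * ((gbar x)⁻¹ * (Matrix.vecMulVec φ (Pi.single k 1) * g x)) =
        Matrix.vecMulVec w (g x k) := by
      rw [Matrix.vecMulVec_mul, Matrix.single_one_vecMul, ← mul_assoc, Matrix.mul_vecMulVec]
      rfl
    have e2 : g x * (Matrix.vecMulVec (Pi.single k 1) φ * ((gbar x)⁻¹ * g x)) =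
        Matrix.vecMulVec (g x k) w := by
      rw [Matrix.vecMulVec_mul, hw', Matrix.mul_vecMulVec, Matrix.mulVec_single_one]
      congr 1
      ext a
      exact ((hg.symm x hx).apply a k).symm
    rw [matPd_mul (hg.differentiableAt hU hx) hd, h, matPd_metric hU hg hx, ← e1, ← e2]
    simp only [Lfield, ← hψ, Matrix.mul_smul, Matrix.smul_mul, mul_assoc, add_mul, mul_sub,
      smul_sub, smul_add]
    abel
  rw [covDeriv2_eq_matPd, hcov, hpd, hpd]
  have s1 := (hg.symm x hx).apply j k
  have s2 := (hg.symm x hx).apply i k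
  simp only [Matrix.neg_apply, Matrix.smul_apply, Matrix.add_apply, Matrix.vecMulVec_apply,
    smul_eq_mul, s1, s2]
  ring

end Connection

/-- Integral curves of a smooth vector field on an open set are smooth. -/
theorem contDiffOn_of_hasDerivAt_comp {E : Type*} [NormedAddCommGroup E] [NormedSpace ℝ E]
    {W : Set E} {F : E → E} (hF : ContDiffOn ℝ (⊤ : ℕ∞) F W) {I : Set ℝ} (hI : IsOpen I)
    {α : ℝ → E} (hα : ∀ t ∈ I, HasDerivAt α (F (α t)) t) (hmem : ∀ t ∈ I, α t ∈ W) :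
    ContDiffOn ℝ (⊤ : ℕ∞) α I := by
  rw [contDiffOn_infty]
  intro m
  induction m with
  | zero =>
    rw [Nat.cast_zero, contDiffOn_zero]
    exact fun t ht => (hα t ht).continuousAt.continuousWithinAt
  | succ m ih =>
    rw [Nat.cast_add, Nat.cast_one, contDiffOn_succ_iff_deriv_of_isOpen hI]
    refine ⟨fun t ht => (hα t ht).differentiableAt.differentiableWithinAt, by simp, ?_⟩
    exact ((contDiffOn_infty.1 hF m).comp ih hmem).congr fun t ht => (hα t ht).deriv

theorem exists_geodesic {n : ℕ} {U : Set (Fin n → ℝ)} (hU : IsOpen U)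
    {g : (Fin n → ℝ) → Matrix (Fin n) (Fin n) ℝ} (hg : IsMetricOn U g)
    {x : Fin n → ℝ} (hx : x ∈ U) {v : Fin n → ℝ} (hv : v ≠ 0) :
    ∃ (γ : ℝ → (Fin n → ℝ)) (I : Set ℝ), IsGeodesicOn U g γ I ∧ 0 ∈ I ∧ γ 0 = x ∧
      (∀ k, deriv (fun s => γ s k) 0 = v k) ∧
      ∀ t ∈ I, ∃ k, deriv (fun s => γ s k) t ≠ 0 := by
  obtain ⟨k₀, hk₀⟩ := Function.ne_iff.1 hv
  let F : (Fin n → ℝ) × (Fin n → ℝ) → (Fin n → ℝ) × (Fin n → ℝ) := fun p =>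
    (p.2, fun k => -∑ i, ∑ j, Gamma g k i j p.1 * p.2 i * p.2 j)
  let W : Set ((Fin n → ℝ) × (Fin n → ℝ)) := {p | p.1 ∈ U ∧ p.2 k₀ ≠ 0}
  have hW : IsOpen W := (hU.preimage continuous_fst).inter
    (isOpen_ne.preimage ((continuous_apply k₀).comp continuous_snd))
  have hxv : (x, v) ∈ W := ⟨hx, hk₀⟩
  have hF : ContDiffOn ℝ (⊤ : ℕ∞) F W := by
    refine contDiffOn_snd.prodMk (contDiffOn_pi.2 fun k => ContDiffOn.neg ?_)
    refine ContDiffOn.sum fun i _ => ContDiffOn.sum fun j _ => ?_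
    have hc : ∀ i : Fin n, ContDiffOn ℝ (⊤ : ℕ∞)
        (fun p : (Fin n → ℝ) × (Fin n → ℝ) => p.2 i) W := fun i => by fun_prop
    exact (((contDiffOn_Gamma hU hg k i j).comp contDiffOn_fst fun p hp => hp.1).mul (hc i)).mul
      (hc j)
  obtain ⟨α, hα0, ε, hε, hα⟩ :=
    ((hF.contDiffAt (hW.mem_nhds hxv)).of_le
      (by simp)).exists_forall_mem_closedBall_exists_eq_forall_mem_Ioo_hasDerivAt₀ 0
  simp only [zero_sub, zero_add] at hα
  have hnear : ∀ᶠ t in nhds (0 : ℝ), α t ∈ W :=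
    (hα 0 ⟨by linarith, hε⟩).continuousAt.eventually (hW.mem_nhds (by rwa [hα0]))
  obtain ⟨δ, hδ, hball⟩ := Metric.eventually_nhds_iff.1 hnear
  let η := min ε δ
  have hη : 0 < η := lt_min hε hδ
  have hαI : ∀ t ∈ Set.Ioo (-η) η, HasDerivAt α (F (α t)) t := fun t ht =>
    hα t ⟨by linarith [ht.1, min_le_left ε δ], by linarith [ht.2, min_le_left ε δ]⟩
  have hmem : ∀ t ∈ Set.Ioo (-η) η, α t ∈ W := fun t ht => hball (by
    rw [Real.dist_0_eq_abs, abs_lt]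
    exact ⟨by linarith [ht.1, min_le_right ε δ], by linarith [ht.2, min_le_right ε δ]⟩)
  have hsm := contDiffOn_of_hasDerivAt_comp hF isOpen_Ioo hαI hmem
  have hd1 : ∀ t ∈ Set.Ioo (-η) η, ∀ k, deriv (fun s => (α s).1 k) t = (α t).2 k := fun t ht k =>
    (hasDerivAt_pi.1 (hαI t ht).fst k).deriv
  have h0 : (0 : ℝ) ∈ Set.Ioo (-η) η := ⟨by linarith, hη⟩
  refine ⟨fun t => (α t).1, Set.Ioo (-η) η, ⟨⟨isOpen_Ioo, Set.ordConnected_Ioo⟩,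
    fun k => contDiffOn_pi.1 hsm.fst k, fun t ht => (hmem t ht).1, fun t ht k => ?_⟩, h0,
    by simp [hα0], fun k => by simp [hd1 0 h0, hα0],
    fun t ht => ⟨k₀, by rw [hd1 t ht]; exact (hmem t ht).2⟩⟩
  have hdd : deriv (fun s => (α s).1 k) =ᶠ[nhds t] fun s => (α s).2 k := by
    filter_upwards [isOpen_Ioo.mem_nhds ht] with s hs using hd1 s hs k
  rw [hdd.deriv_eq, (hasDerivAt_pi.1 (hαI t ht).snd k).deriv]
  simp only [hd1 t ht, F]
  ring

/-- Projective equivalence forces the difference of the connections to preserve directions. -/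
theorem ProjEquiv.exists_smul {n : ℕ} {U : Set (Fin n → ℝ)} (hU : IsOpen U)
    {g gbar : (Fin n → ℝ) → Matrix (Fin n) (Fin n) ℝ} (hg : IsMetricOn U g)
    (hproj : ProjEquiv U g gbar) {x : Fin n → ℝ} (hx : x ∈ U) {v : Fin n → ℝ} (hv : v ≠ 0) :
    ∃ c : ℝ, ∀ k, ∑ i, ∑ j, (Gamma gbar k i j x - Gamma g k i j x) * v i * v j = c * v k := by
  obtain ⟨γ, I, hγ, h0, hγ0, hγ1, hne⟩ := exists_geodesic hU hg hx hv
  obtain ⟨φ, J, hJ, hφ, -, hφJ, hφ', hγφ⟩ := hproj γ I hγ hne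
  obtain ⟨s, hs, hφs⟩ : (0 : ℝ) ∈ φ '' J := hφJ ▸ h0
  have hφI : ∀ t ∈ J, φ t ∈ I := fun t ht => hφJ ▸ Set.mem_image_of_mem φ ht
  have hφd : ∀ t ∈ J, DifferentiableAt ℝ φ t := fun t ht =>
    (hφ.contDiffAt (hJ.1.mem_nhds ht)).differentiableAt (by simp)
  have hφdd : DifferentiableAt ℝ (deriv φ) s :=
    (((contDiffOn_infty_iff_deriv_of_isOpen hJ.1).1 hφ).2.contDiffAt
      (hJ.1.mem_nhds hs)).differentiableAt (by simp)
  have hγd : ∀ k, ∀ t ∈ I, DifferentiableAt ℝ (fun u => γ u k) t := fun k t ht =>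
    ((hγ.smooth k).contDiffAt (hγ.interval.1.mem_nhds ht)).differentiableAt (by simp)
  have hγdd : ∀ k, DifferentiableAt ℝ (deriv fun u => γ u k) 0 := fun k =>
    (((contDiffOn_infty_iff_deriv_of_isOpen hγ.interval.1).1 (hγ.smooth k)).2.contDiffAt
      (hγ.interval.1.mem_nhds h0)).differentiableAt (by simp)
  have hβ : ∀ k, ∀ t ∈ J, deriv (fun u => γ (φ u) k) t =
      deriv (fun u => γ u k) (φ t) * deriv φ t := fun k t ht =>
    ((hγd k _ (hφI t ht)).hasDerivAt.comp t (hφd t ht).hasDerivAt).deriv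
  have hββ : ∀ k, deriv (deriv fun u => γ (φ u) k) s =
      deriv (deriv fun u => γ u k) 0 * deriv φ s * deriv φ s + v k * deriv (deriv φ) s := by
    intro k
    have : (deriv fun u => γ (φ u) k) =ᶠ[nhds s]
        fun t => deriv (fun u => γ u k) (φ t) * deriv φ t := by
      filter_upwards [hJ.1.mem_nhds hs] with t ht using hβ k t ht
    have hc : HasDerivAt (fun t => deriv (fun u => γ u k) (φ t))
        (deriv (deriv fun u => γ u k) 0 * deriv φ s) s :=
      HasDerivAt.comp (h₂ := deriv fun u => γ u k) s (by rw [hφs]; exact (hγdd k).hasDerivAt)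
        (hφd s hs).hasDerivAt
    rw [this.deriv_eq, (hc.fun_mul hφdd.hasDerivAt).deriv, hφs, hγ1]
  have hne' := hφ' s hs
  refine ⟨-deriv (deriv φ) s / deriv φ s ^ 2, fun k => ?_⟩
  have e1 := hγ.eqn 0 h0 k
  have e2 := hγφ.eqn s hs k
  simp only [hγ1, hγ0] at e1
  simp only [Function.comp_apply, hββ, hβ _ s hs, hφs, hγ1, hγ0] at e2
  have e3 : ∑ i, ∑ j, Gamma gbar k i j x * (v i * deriv φ s) * (v j * deriv φ s) =
      deriv φ s ^ 2 * ∑ i, ∑ j, Gamma gbar k i j x * v i * v j := by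
    simp only [Finset.mul_sum]
    exact Finset.sum_congr rfl fun i _ => Finset.sum_congr rfl fun j _ => by ring
  rw [e3] at e2
  simp only [sub_mul, Finset.sum_sub_distrib]
  field_simp
  linear_combination e2 - deriv φ s ^ 2 * e1

/-- A symmetric bilinear map `D` with `D(v, v)` always proportional to `v` is of the form
`D(u, v) = φ(u) v + φ(v) u`. -/
theorem exists_covector_of_forall_smul {n : ℕ} (D : Fin n → Fin n → Fin n → ℝ)
    (hsymm : ∀ k i j, D k i j = D k j i)
    (hD : ∀ v : Fin n → ℝ, v ≠ 0 → ∃ c : ℝ, ∀ k, ∑ i, ∑ j, D k i j * v i * v j = c * v k) :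
    ∃ φ : Fin n → ℝ, ∀ a k b, D a k b =
      φ k * (if a = b then 1 else 0) + φ b * (if a = k then 1 else 0) := by
  have hdiag : ∀ a i, a ≠ i → D a i i = 0 := fun a i hai => by
    obtain ⟨c, hc⟩ := hD (Pi.single i 1) (by simp)
    simpa [Pi.single_apply, hai] using hc a
  have hpair : ∀ i j, i ≠ j → ∀ s : ℝ, ∃ c : ℝ, ∀ a,
      D a i i + 2 * s * D a i j + s ^ 2 * D a j j =
        c * ((if a = i then 1 else 0) + s * (if a = j then 1 else 0)) := fun i j hij s => by
    obtain ⟨c, hc⟩ := hD (fun l => (if l = i then 1 else 0) + s * (if l = j then 1 else 0))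
      fun h => by simpa [hij] using congrFun h i
    refine ⟨c, fun a => ?_⟩
    rw [← hc a]
    simp only [mul_add, add_mul, Finset.sum_add_distrib, mul_ite, mul_one, mul_zero, ite_mul,
      zero_mul, Finset.sum_ite_eq', Finset.mem_univ, if_true]
    rw [hsymm a j i]
    ring
  have hoff : ∀ a i j, i ≠ j → a ≠ i → a ≠ j → D a i j = 0 := fun a i j hij hai haj => by
    obtain ⟨c, hc⟩ := hpair i j hij 1
    have := hc a
    simp only [hai, haj, hdiag, if_false, ne_eq, not_false_eq_true] at this
    linarith
  have hmix : ∀ i j, i ≠ j → D j i j = D i i i / 2 := fun i j hij => by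
    obtain ⟨c, hc⟩ := hpair i j hij 1
    obtain ⟨d, hd⟩ := hpair i j hij (-1)
    have h1 := hc i
    have h2 := hc j
    have h3 := hd i
    have h4 := hd j
    simp only [hij, hij.symm, hdiag, if_false, if_true, ne_eq, not_false_eq_true] at h1 h2 h3 h4
    linarith
  refine ⟨fun i => D i i i / 2, fun a k b => ?_⟩
  by_cases hab : a = b
  · by_cases hak : a = k
    · subst hab hak
      simp
    · subst hab
      simp [hak, hmix k a (Ne.symm hak)]
  · by_cases hak : a = k
    · subst hak
      simp [hab, hsymm a a b, hmix b a (Ne.symm hab)]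
    · by_cases hkb : k = b
      · subst hkb
        simp [hab, hdiag a k hak]
      · simp [hab, hak, hoff a k b hkb hak hab]

theorem covariant_derivative_of_lowered_L {n : ℕ} (hn : 2 ≤ n) (U : Set (Fin n → ℝ)) (hUo : IsOpen U) (hUc : IsConnected U)
    (g gbar : (Fin n → ℝ) → Matrix (Fin n) (Fin n) ℝ)
    (hg : IsMetricOn U g) (hgbar : IsMetricOn U gbar)
    (hproj : ProjEquiv U g gbar) :
    ∀ x ∈ U, ∀ k i j : Fin n,
      covDeriv2 g (fun y => g y * Lfield g gbar y) k i j x =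
        pd i (fun y => (1/2) * (Lfield g gbar y).trace) x * g x j k +
          pd j (fun y => (1/2) * (Lfield g gbar y).trace) x * g x i k := by
  intro x hx k i j
  obtain ⟨φ, hφ⟩ := exists_covector_of_forall_smul
    (fun a k b => Gamma gbar a k b x - Gamma g a k b x)
    (fun a k b => by rw [Gamma_symm hUo hg hx a k b, Gamma_symm hUo hgbar hx a k b])
    fun v hv => hproj.exists_smul hUo hg hx hv
  exact covDeriv2_lowered_Lfield hUo hg hgbar hx hφ k i j
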